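/- For the bilinear map β_{μ,σ} defined in the context and any unit vector u = Σ_{a=1}^m u_a ξ_a ∈ W: if u₁ + u₂ > 0, then Index A_u(β_{μ,σ}) = 2, and if u₁ + u₂ < 0, then Index A_u(β_{μ,σ}) = n − 2. Moreover, the eigenvalues of A_u(β_{μ,σ}) are μ(u₁²+u₂²)^{1/2}, −μ(u₁²+u₂²)^{1/2}, −σ(u₁+u₂), and σ(u₁+u₂) with multiplicity n−3. -/

import Mathlib

open scoped RealInnerProductSpace BigOperators
open MeasureTheory Classical

namespace Paper

variable {V W : Type*} [NormedAddCommGroup V] [InnerProductSpace ℝ V]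
  [NormedAddCommGroup W] [InnerProductSpace ℝ W]

/-- `β` is a symmetric bilinear map. -/
def IsSymmBil (β : V →ₗ[ℝ] V →ₗ[ℝ] W) : Prop := ∀ x y, β x y = β y x

/-- The formal shape operator `A_ξ(β)`, determined by `⟪β x y, ξ⟫ = ⟪A_ξ(β) x, y⟫`. -/
noncomputable def shapeOp (β : V →ₗ[ℝ] V →ₗ[ℝ] W) (ξ : W) : V →ₗ[ℝ] V :=
  if h : ∃ A : V →ₗ[ℝ] V, ∀ x y : V, ⟪β x y, ξ⟫ = ⟪A x, y⟫ then h.choose else 0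

variable {n m : ℕ}

/-- The mean curvature vector `𝓗_β = (1/n) Σ_i β(e_i, e_i)`. -/
noncomputable def meanCurv (e : OrthonormalBasis (Fin n) ℝ V)
    (β : V →ₗ[ℝ] V →ₗ[ℝ] W) : W :=
  (n : ℝ)⁻¹ • ∑ i, β (e i) (e i)

/-- The formal Ricci tensor `Ric_c(β)`. -/
noncomputable def ric (c : ℝ) (e : OrthonormalBasis (Fin n) ℝ V)
    (β : V →ₗ[ℝ] V →ₗ[ℝ] W) (x y : V) : ℝ :=
  c * (n - 1) * ⟪x, y⟫ + n * ⟪meanCurv e β, β x y⟫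
    - ∑ i, ⟪β x (e i), β y (e i)⟫

/-- The normalized scalar curvature `ρ_c(β) = (1/(n(n-1))) tr Ric_c(β)`. -/
noncomputable def rho (c : ℝ) (e : OrthonormalBasis (Fin n) ℝ V)
    (β : V →ₗ[ℝ] V →ₗ[ℝ] W) : ℝ :=
  (n * (n - 1) : ℝ)⁻¹ * ∑ i, ric c e β (e i) (e i)

/-- The self-adjoint operator `T_c(β)` with `⟪T_c(β) x, y⟫ = (1/(n-1)) Ric_c(β)(x,y)`. -/
noncomputable def ricOp (c : ℝ) (e : OrthonormalBasis (Fin n) ℝ V)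
    (β : V →ₗ[ℝ] V →ₗ[ℝ] W) : V →ₗ[ℝ] V :=
  if h : ∃ T : V →ₗ[ℝ] V, ∀ x y : V, ⟪T x, y⟫ = (n - 1 : ℝ)⁻¹ * ric c e β x y
  then h.choose else 0

/-- The increasingly ordered eigenvalues of an endomorphism admitting an orthonormal
eigenbasis (junk value otherwise). -/
noncomputable def sortedEigs (n : ℕ) (T : V →ₗ[ℝ] V) : Fin n → ℝ :=
  if h : ∃ μ : Fin n → ℝ, Monotone μ ∧
      ∃ b : OrthonormalBasis (Fin n) ℝ V, ∀ i, T (b i) = μ i • b i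
  then h.choose else fun _ => 0

/-- The `k`-th scalar curvature `ρ_{c,k}(β) = (1/k) Σ_{i=1}^k λ_{c,i}(β)`. -/
noncomputable def rhoK (c : ℝ) (k : ℕ) (e : OrthonormalBasis (Fin n) ℝ V)
    (β : V →ₗ[ℝ] V →ₗ[ℝ] W) : ℝ :=
  (k : ℝ)⁻¹ * ∑ i ∈ Finset.univ.filter (fun i : Fin n => (i : ℕ) < k),
    sortedEigs n (ricOp c e β) i

/-- The normal scalar curvature `ρ⊥(β)`. -/
noncomputable def rhoPerp (e : OrthonormalBasis (Fin n) ℝ V)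
    (ξ : OrthonormalBasis (Fin m) ℝ W) (β : V →ₗ[ℝ] V →ₗ[ℝ] W) : ℝ :=
  (n * (n - 1) : ℝ)⁻¹ * Real.sqrt (∑ a, ∑ b, ∑ i,
    ‖(shapeOp β (ξ a) ∘ₗ shapeOp β (ξ b) - shapeOp β (ξ b) ∘ₗ shapeOp β (ξ a)) (e i)‖ ^ 2)

/-- The index of a self-adjoint endomorphism: the number of negative eigenvalues,
counted with multiplicity. -/
noncomputable def negIndex (n : ℕ) (T : V →ₗ[ℝ] V) : ℕ :=
  (Finset.univ.filter (fun i : Fin n => sortedEigs n T i < 0)).card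

/-- The Hilbert–Schmidt norm `‖β‖² = Σ_{i,j} ‖β(e_i,e_j)‖²`. -/
noncomputable def normHS (e : OrthonormalBasis (Fin n) ℝ V)
    (β : V →ₗ[ℝ] V →ₗ[ℝ] W) : ℝ :=
  Real.sqrt (∑ i, ∑ j, ‖β (e i) (e j)‖ ^ 2)

/-- `ψ_p(β) = ∫_{Λ_p(β)} |det A_u(β)| dS_u` over the unit sphere of `W = ℝ^m`. -/
noncomputable def psi (n m p : ℕ)
    (β : EuclideanSpace ℝ (Fin n) →ₗ[ℝ] EuclideanSpace ℝ (Fin n) →ₗ[ℝ]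
      EuclideanSpace ℝ (Fin m)) : ℝ :=
  ∫ u in {u : Metric.sphere (0 : EuclideanSpace ℝ (Fin m)) 1 |
      p < negIndex n (shapeOp β (u : EuclideanSpace ℝ (Fin m))) ∧
      negIndex n (shapeOp β (u : EuclideanSpace ℝ (Fin m))) < n - p},
    |LinearMap.det (shapeOp β (u : EuclideanSpace ℝ (Fin m)))|
    ∂((volume : Measure (EuclideanSpace ℝ (Fin m))).toSphere)


/-- The endomorphism `A₁` of `ℝⁿ` from the counterexample. -/
noncomputable def A1 (n : ℕ) (μ σ : ℝ) :
    EuclideanSpace ℝ (Fin n) →ₗ[ℝ] EuclideanSpace ℝ (Fin n) :=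
  Matrix.toEuclideanLin (Matrix.diagonal fun i : Fin n =>
    if (i : ℕ) = 0 then μ else if (i : ℕ) = 1 then -μ else if (i : ℕ) = 2 then -σ else σ)

/-- The endomorphism `A₂` of `ℝⁿ` from the counterexample. -/
noncomputable def A2 (n : ℕ) (μ σ : ℝ) :
    EuclideanSpace ℝ (Fin n) →ₗ[ℝ] EuclideanSpace ℝ (Fin n) :=
  Matrix.toEuclideanLin (Matrix.of fun i j : Fin n =>
    if ((i : ℕ) = 0 ∧ (j : ℕ) = 1) ∨ ((i : ℕ) = 1 ∧ (j : ℕ) = 0) then μ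
    else if i = j ∧ (i : ℕ) = 2 then -σ
    else if i = j ∧ 3 ≤ (i : ℕ) then σ else 0)

/-- The symmetric bilinear map `β_{μ,σ}(x,y) = ⟨A₁x,y⟩ξ₁ + ⟨A₂x,y⟩ξ₂`. -/
noncomputable def betaMS (n m : ℕ) (hm : 2 ≤ m) (μ σ : ℝ) : EuclideanSpace ℝ (Fin n) →ₗ[ℝ] EuclideanSpace ℝ (Fin n) →ₗ[ℝ] EuclideanSpace ℝ (Fin m) :=
  LinearMap.mk₂ ℝ
    (fun x y => ⟪A1 n μ σ x, y⟫ • (EuclideanSpace.basisFun (Fin m) ℝ ⟨0, by omega⟩)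
      + ⟪A2 n μ σ x, y⟫ • (EuclideanSpace.basisFun (Fin m) ℝ ⟨1, by omega⟩))
    (by intro x x' y; simp only [map_add, inner_add_left, add_smul]; abel)
    (by intro a x y; simp only [_root_.map_smul, real_inner_smul_left, smul_add, smul_smul])
    (by intro x y y'; simp only [inner_add_right, add_smul]; abel)
    (by intro a x y; simp only [real_inner_smul_right, smul_add, smul_smul])

/-- The standard basis vectors are eigenvectors of `A₁`. -/
theorem A1_single (n : ℕ) (μ σ : ℝ) (i : Fin n) :
    A1 n μ σ (EuclideanSpace.single i 1) =
      (if (i : ℕ) = 0 then μ else if (i : ℕ) = 1 then -μ else if (i : ℕ) = 2 then -σ else σ) •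
        EuclideanSpace.single i (1 : ℝ) := by
  ext j
  rw [PiLp.smul_apply]
  simp only [A1, Matrix.toLpLin_apply, PiLp.ofLp_single, Matrix.mulVec_single_one,
    Matrix.col_apply, Matrix.diagonal_apply, PiLp.single_apply, smul_eq_mul]
  grind

theorem A2_single (n : ℕ) (μ σ : ℝ) (i j : Fin n) :
    A2 n μ σ (EuclideanSpace.single i 1) j =
      if ((j : ℕ) = 0 ∧ (i : ℕ) = 1) ∨ ((j : ℕ) = 1 ∧ (i : ℕ) = 0) then μ
      else if j = i ∧ (j : ℕ) = 2 then -σ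
      else if j = i ∧ 3 ≤ (j : ℕ) then σ else 0 := by
  simp [A2, Matrix.toLpLin_apply]

/-- The shape operator of `β_{μ,σ}` is the combination `u₁ A₁ + u₂ A₂`. -/
theorem shapeOp_betaMS (n m : ℕ) (hm : 2 ≤ m) (μ σ : ℝ) (u : EuclideanSpace ℝ (Fin m)) :
    shapeOp (betaMS n m hm μ σ) u =
      u ⟨0, by omega⟩ • A1 n μ σ + u ⟨1, by omega⟩ • A2 n μ σ := by
  have key : ∀ x y, ⟪betaMS n m hm μ σ x y, u⟫ =
      ⟪(u ⟨0, by omega⟩ • A1 n μ σ + u ⟨1, by omega⟩ • A2 n μ σ) x, y⟫ := by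
    intro x y
    simp [betaMS, inner_add_left, real_inner_smul_left, EuclideanSpace.inner_single_left]
    ring
  have h : ∃ A : EuclideanSpace ℝ (Fin n) →ₗ[ℝ] EuclideanSpace ℝ (Fin n),
      ∀ x y, ⟪betaMS n m hm μ σ x y, u⟫ = ⟪A x, y⟫ := ⟨_, key⟩
  rw [shapeOp, dif_pos h]
  refine LinearMap.ext fun x => ext_inner_right ℝ fun y => ?_
  rw [← h.choose_spec, key]

/-- The eigenvalues along an eigenbasis are the roots of the characteristic polynomial. -/
theorem roots_charpoly_of_eigenbasis {ι : Type*} [Fintype ι] [FiniteDimensional ℝ V]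
    (T : V →ₗ[ℝ] V) (b : Module.Basis ι ℝ V) (ν : ι → ℝ) (h : ∀ i, T (b i) = ν i • b i) :
    T.charpoly.roots = Finset.univ.val.map ν := by
  have hT : LinearMap.toMatrix b b T = Matrix.diagonal ν := by
    ext i j
    rw [LinearMap.toMatrix_apply, h, map_smul, b.repr_self, Finsupp.smul_apply,
      Finsupp.single_apply, Matrix.diagonal_apply]
    by_cases hij : i = j <;> simp [hij, eq_comm]
  rw [← LinearMap.charpoly_toMatrix T b, hT, Matrix.charpoly_diagonal]
  simpa using Polynomial.roots_multiset_prod_X_sub_C (Finset.univ.val.map ν)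

/-- The index can be read off from any orthonormal eigenbasis. -/
theorem negIndex_eq_countP (T : V →ₗ[ℝ] V) (b : OrthonormalBasis (Fin n) ℝ V) (ν : Fin n → ℝ)
    (h : ∀ i, T (b i) = ν i • b i) :
    negIndex n T = (Finset.univ.val.map ν).countP (· < 0) := by
  have : FiniteDimensional ℝ V := b.toBasis.finiteDimensional_of_finite
  have hex : ∃ μ : Fin n → ℝ, Monotone μ ∧
      ∃ b : OrthonormalBasis (Fin n) ℝ V, ∀ i, T (b i) = μ i • b i :=
    ⟨ν ∘ Tuple.sort ν, Tuple.monotone_sort ν, b.reindex (Tuple.sort ν).symm, by simp [h]⟩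
  obtain ⟨-, b', hb'⟩ := hex.choose_spec
  have hs : sortedEigs n T = hex.choose := dif_pos hex
  rw [← roots_charpoly_of_eigenbasis T b.toBasis ν (by simpa using h),
    roots_charpoly_of_eigenbasis T b'.toBasis _ (by simpa using hb'), negIndex, hs,
    Multiset.countP_map]
  rfl

/-- Half-angle parametrization of a planar vector. -/
theorem exists_half_angle (x y : ℝ) : ∃ c s : ℝ, c ^ 2 + s ^ 2 = 1 ∧
    x = √(x ^ 2 + y ^ 2) * (c ^ 2 - s ^ 2) ∧ y = √(x ^ 2 + y ^ 2) * (2 * s * c) := by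
  have hr : √(x ^ 2 + y ^ 2) = ‖(⟨x, y⟩ : ℂ)‖ := by
    rw [Complex.norm_def, Complex.normSq_mk]; ring_nf
  set θ := Complex.arg ⟨x, y⟩ with hθ
  refine ⟨Real.cos (θ / 2), Real.sin (θ / 2), Real.cos_sq_add_sin_sq _, ?_, ?_⟩
  · rw [← Real.cos_two_mul', mul_div_cancel₀ θ two_ne_zero, hr, Complex.norm_mul_cos_arg]
  · rw [← Real.sin_two_mul, mul_div_cancel₀ θ two_ne_zero, hr, Complex.norm_mul_sin_arg]

/-- The standard basis with its first two vectors rotated. -/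
theorem exists_rotated_basis (k : ℕ) {c s : ℝ} (h : c ^ 2 + s ^ 2 = 1) :
    ∃ b : OrthonormalBasis (Fin (k + 2)) ℝ (EuclideanSpace ℝ (Fin (k + 2))),
      b 0 = c • EuclideanSpace.single 0 1 + s • EuclideanSpace.single 1 1 ∧
      b 1 = -s • EuclideanSpace.single 0 1 + c • EuclideanSpace.single 1 1 ∧
      ∀ i : Fin k, b i.succ.succ = EuclideanSpace.single i.succ.succ 1 := by
  let v : Fin (k + 2) → EuclideanSpace ℝ (Fin (k + 2)) :=
    Fin.cons (c • EuclideanSpace.single 0 1 + s • EuclideanSpace.single 1 1)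
      (Fin.cons (-s • EuclideanSpace.single 0 1 + c • EuclideanSpace.single 1 1)
        fun i => EuclideanSpace.single i.succ.succ 1)
  have hv0 : v 0 = c • EuclideanSpace.single 0 1 + s • EuclideanSpace.single 1 1 := rfl
  have hv1 : v 1 = -s • EuclideanSpace.single 0 1 + c • EuclideanSpace.single 1 1 := rfl
  have hv : ∀ i : Fin k, v i.succ.succ = EuclideanSpace.single i.succ.succ 1 := fun i => rfl
  have hon : Orthonormal ℝ v := by
    have he : ∀ i j : Fin (k + 2), ⟪EuclideanSpace.single i (1 : ℝ), EuclideanSpace.single j 1⟫ =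
        if i = j then 1 else 0 := orthonormal_iff_ite.1 EuclideanSpace.orthonormal_single
    rw [orthonormal_iff_ite]
    intro i j
    refine Fin.cases ?_ (Fin.cases ?_ fun i => ?_) i <;>
      refine Fin.cases ?_ (Fin.cases ?_ fun j => ?_) j <;>
      simp only [Fin.succ_zero_eq_one, hv0, hv1, hv, inner_add_left, inner_add_right,
        real_inner_smul_left, real_inner_smul_right, he] <;>
      simp [Fin.ext_iff] <;>
      linarith
  refine ⟨OrthonormalBasis.mk hon
    (hon.linearIndependent.span_eq_top_of_card_eq_finrank (by simp)).ge, ?_⟩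
  simp [hv0, hv1, hv]

theorem exists_eigenbasis (k : ℕ) (μ σ x y : ℝ) :
    ∃ (b : OrthonormalBasis (Fin (k + 3)) ℝ (EuclideanSpace ℝ (Fin (k + 3))))
      (ν : Fin (k + 3) → ℝ),
      (∀ i, (x • A1 (k + 3) μ σ + y • A2 (k + 3) μ σ) (b i) = ν i • b i) ∧
      Finset.univ.val.map ν =
        ({μ * √(x ^ 2 + y ^ 2), -(μ * √(x ^ 2 + y ^ 2)), -(σ * (x + y))} : Multiset ℝ)
          + Multiset.replicate k (σ * (x + y)) := by
  obtain ⟨c, s, hcs, hx, hy⟩ := exists_half_angle x y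
  obtain ⟨b, hb0, hb1, hb⟩ :
      ∃ b : OrthonormalBasis (Fin (k + 3)) ℝ (EuclideanSpace ℝ (Fin (k + 3))),
        b 0 = c • EuclideanSpace.single 0 1 + s • EuclideanSpace.single 1 1 ∧
        b 1 = -s • EuclideanSpace.single 0 1 + c • EuclideanSpace.single 1 1 ∧
        ∀ i : Fin (k + 1), b i.succ.succ = EuclideanSpace.single i.succ.succ 1 :=
    exists_rotated_basis (k + 1) hcs
  set r := √(x ^ 2 + y ^ 2)
  have hA20 : A2 (k + 3) μ σ (EuclideanSpace.single 0 1) =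
      μ • EuclideanSpace.single 1 (1 : ℝ) := by
    ext j
    rw [A2_single, PiLp.smul_apply, PiLp.single_apply, smul_eq_mul]
    clear * -
    simp only [Fin.ext_iff, Fin.val_zero, Fin.val_one]
    grind
  have hA21 : A2 (k + 3) μ σ (EuclideanSpace.single 1 1) =
      μ • EuclideanSpace.single 0 (1 : ℝ) := by
    ext j
    rw [A2_single, PiLp.smul_apply, PiLp.single_apply, smul_eq_mul]
    clear * -
    simp only [Fin.ext_iff, Fin.val_zero, Fin.val_one]
    grind
  have hA2 : ∀ i : Fin (k + 1), A2 (k + 3) μ σ (EuclideanSpace.single i.succ.succ 1) =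
      (if i = 0 then -σ else σ) • EuclideanSpace.single i.succ.succ (1 : ℝ) := by
    intro i
    ext j
    rw [A2_single, PiLp.smul_apply, PiLp.single_apply, smul_eq_mul]
    clear * -
    grind
  have h0 : (x • A1 (k + 3) μ σ + y • A2 (k + 3) μ σ) (b 0) = (μ * r) • b 0 := by
    simp only [hb0, LinearMap.add_apply, LinearMap.smul_apply, map_add, map_smul, A1_single,
      hA20, hA21, Fin.val_zero, Fin.val_one, if_true, one_ne_zero, if_false]
    match_scalars
    · linear_combination c * μ * hx + s * μ * hy + c * μ * r * hcs
    · linear_combination -s * μ * hx + c * μ * hy + s * μ * r * hcs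
  have h1 : (x • A1 (k + 3) μ σ + y • A2 (k + 3) μ σ) (b 1) = (-(μ * r)) • b 1 := by
    simp only [hb1, LinearMap.add_apply, LinearMap.smul_apply, map_add, map_smul, A1_single,
      hA20, hA21, Fin.val_zero, Fin.val_one, if_true, one_ne_zero, if_false]
    match_scalars
    · linear_combination -s * μ * hx + c * μ * hy + s * μ * r * hcs
    · linear_combination -c * μ * hx - s * μ * hy - c * μ * r * hcs
  have h2 : ∀ i : Fin (k + 1), (x • A1 (k + 3) μ σ + y • A2 (k + 3) μ σ) (b i.succ.succ) =
      (if i = 0 then -(σ * (x + y)) else σ * (x + y)) • b i.succ.succ := by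
    intro i
    simp only [hb, LinearMap.add_apply, LinearMap.smul_apply, A1_single, hA2, Fin.val_succ,
      Fin.ext_iff, Fin.val_zero, smul_smul, ← add_smul]
    congr 1
    grind
  refine ⟨b, Fin.cons (μ * r) (Fin.cons (-(μ * r)) (Fin.cons (-(σ * (x + y)))
    fun _ => σ * (x + y))), ?_, ?_⟩
  · exact Fin.cases h0 (Fin.cases h1 (Fin.cases (h2 0) fun i => h2 i.succ))
  · simp [Multiset.insert_eq_cons, ← Multiset.coe_replicate]

theorem stmt16 (n m : ℕ) (hn : 3 ≤ n) (hm : 2 ≤ m)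
    (μ σ : ℝ) (hμ : 0 < μ) (hσ : 0 < σ)
    (u : EuclideanSpace ℝ (Fin m)) (hu : ‖u‖ = 1) :
    (0 < u ⟨0, by omega⟩ + u ⟨1, by omega⟩ →
      negIndex n (shapeOp (betaMS n m hm μ σ) u) = 2) ∧
    (u ⟨0, by omega⟩ + u ⟨1, by omega⟩ < 0 →
      negIndex n (shapeOp (betaMS n m hm μ σ) u) = n - 2) ∧
    ∃ (b : OrthonormalBasis (Fin n) ℝ (EuclideanSpace ℝ (Fin n))) (ν : Fin n → ℝ),
      (∀ i, shapeOp (betaMS n m hm μ σ) u (b i) = ν i • b i) ∧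
      Finset.univ.val.map ν =
        ({μ * Real.sqrt ((u ⟨0, by omega⟩) ^ 2 + (u ⟨1, by omega⟩) ^ 2),
          -(μ * Real.sqrt ((u ⟨0, by omega⟩) ^ 2 + (u ⟨1, by omega⟩) ^ 2)),
          -(σ * (u ⟨0, by omega⟩ + u ⟨1, by omega⟩))} : Multiset ℝ)
          + Multiset.replicate (n - 3) (σ * (u ⟨0, by omega⟩ + u ⟨1, by omega⟩)) := by
  obtain ⟨k, rfl⟩ : ∃ k, n = k + 3 := ⟨n - 3, by omega⟩
  simp only [shapeOp_betaMS]
  generalize u ⟨0, by omega⟩ = x, u ⟨1, by omega⟩ = y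
  obtain ⟨b, ν, hb, hν⟩ := exists_eigenbasis k μ σ x y
  rw [negIndex_eq_countP _ b ν hb, hν]
  refine ⟨fun h => ?_, fun h => ?_, b, ν, hb, hν⟩
  · have hr : 0 < μ * √(x ^ 2 + y ^ 2) :=
      mul_pos hμ (Real.sqrt_pos.2 (by nlinarith [sq_nonneg (x - y)]))
    have hs := mul_pos hσ h
    simp [Multiset.insert_eq_cons, ← Multiset.coe_replicate, List.countP_replicate, hr, hr.le, hs,
      hs.le]
  · have hr : 0 < μ * √(x ^ 2 + y ^ 2) :=
      mul_pos hμ (Real.sqrt_pos.2 (by nlinarith [sq_nonneg (x - y)]))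
    have hs := mul_neg_of_pos_of_neg hσ h
    simp [Multiset.insert_eq_cons, ← Multiset.coe_replicate, List.countP_replicate, hr, hr.le, hs,
      hs.le]

end Paper
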